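/- Let X be an infinite-dimensional real Banach space with the alternative Daugavet property. Then the dual space X* contains a closed subspace isomorphic to ℓ1, i.e. there is a bounded linear map from ℓ1 into X* which is bounded below. -/

import Mathlib

open Bornology Metric Topology

/-- A real Banach space `X` has the alternative Daugavet property: every rank-one
operator `T = x ↦ f(x) • y` satisfies `max {‖Id + T‖, ‖Id - T‖} = 1 + ‖T‖`. -/
def RealAlternativeDaugavetProperty (X : Type*) [NormedAddCommGroup X]
    [NormedSpace ℝ X] : Prop :=
  ∀ (f : X →L[ℝ] ℝ) (y : X),
    max ‖ContinuousLinearMap.id ℝ X + f.smulRight y‖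
        ‖ContinuousLinearMap.id ℝ X - f.smulRight y‖ = 1 + ‖f.smulRight y‖

/-- The Banach space `E` contains an isomorphic copy of `ℓ₁`: there is a bounded linear
map from `ℓ₁` into `E` which is bounded below (an isomorphic embedding). -/
def ContainsCopyOfL1 (E : Type*) [SeminormedAddCommGroup E] [NormedSpace ℝ E] : Prop :=
  ∃ T : lp (fun _ : ℕ => ℝ) 1 →L[ℝ] E, ∃ c : ℝ, 0 < c ∧ ∀ v, c * ‖v‖ ≤ ‖T v‖

lemma l1_of_seq {Z : Type*} [NormedAddCommGroup Z] [NormedSpace ℝ Z] [CompleteSpace Z]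
    (g : ℕ → Z) (C c : ℝ) (hC : ∀ i, ‖g i‖ ≤ C) (hc : 0 < c)
    (h : ∀ (N : ℕ) (a : ℕ → ℝ), c * ∑ i ∈ Finset.range N, |a i| ≤
      ‖∑ i ∈ Finset.range N, a i • g i‖) : ContainsCopyOfL1 Z := by
  have hs : ∀ v : lp (fun _ : ℕ => ℝ) 1, HasSum (fun i => |v i|) ‖v‖ := by
    intro v
    have := lp.hasSum_norm (p := 1) (by norm_num) v
    simpa using this
  have hsum : ∀ v : lp (fun _ : ℕ => ℝ) 1, Summable (fun i => ‖v i • g i‖) := by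
    intro v
    refine Summable.of_nonneg_of_le (fun _ => norm_nonneg _) (fun i => ?_)
      ((hs v).summable.mul_right C)
    rw [norm_smul, Real.norm_eq_abs]
    exact mul_le_mul_of_nonneg_left (hC i) (abs_nonneg _)
  let T : lp (fun _ : ℕ => ℝ) 1 →ₗ[ℝ] Z :=
    { toFun := fun v => ∑' i, v i • g i
      map_add' := by
        intro v w
        rw [← (hsum v).of_norm.tsum_add (hsum w).of_norm]
        congr 1; ext i
        simp [add_smul]
      map_smul' := by
        intro r v
        rw [RingHom.id_apply, ← (hsum v).of_norm.tsum_const_smul]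
        congr 1; ext i
        simp [mul_smul] }
  refine ⟨T.mkContinuous C ?_, c, hc, ?_⟩
  · intro v
    refine (norm_tsum_le_tsum_norm (hsum v)).trans ?_
    rw [mul_comm, ← (hs v).tsum_eq, ← tsum_mul_right]
    refine (hsum v).tsum_le_tsum (fun i => ?_) ((hs v).summable.mul_right C)
    rw [norm_smul, Real.norm_eq_abs]
    exact mul_le_mul_of_nonneg_left (hC i) (abs_nonneg _)
  · intro v
    have h1 := ((hs v).tendsto_sum_nat).const_mul c
    have h2 := ((hsum v).of_norm.hasSum.tendsto_sum_nat).norm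
    exact le_of_tendsto_of_tendsto' h1 h2 (fun N => h N _)

lemma l1_of_indep {Z : Type*} [NormedAddCommGroup Z] [NormedSpace ℝ Z] [CompleteSpace Z]
    (g : ℕ → Z) (hC : ∀ i, ‖g i‖ ≤ 1) (r δ : ℝ) (hδ : 0 < δ)
    (h : ∀ (N : ℕ) (θ : ℕ → Prop), ∃ ω : Z →L[ℝ] ℝ, ‖ω‖ ≤ 1 ∧ ∀ i < N,
      (θ i → r + δ ≤ ω (g i)) ∧ (¬ θ i → ω (g i) ≤ r)) : ContainsCopyOfL1 Z := by
  refine l1_of_seq g 1 (δ / 2) hC (by linarith) ?_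
  intro N a
  obtain ⟨ω, hω, h1⟩ := h N (fun i => 0 ≤ a i)
  obtain ⟨ω', hω', h2⟩ := h N (fun i => ¬ 0 ≤ a i)
  have key : δ * ∑ i ∈ Finset.range N, |a i| ≤ (ω - ω') (∑ i ∈ Finset.range N, a i • g i) := by
    rw [map_sum, Finset.mul_sum]
    refine Finset.sum_le_sum (fun i hi => ?_)
    have hi := Finset.mem_range.1 hi
    have e1 := h1 i hi
    have e2 := h2 i hi
    simp only [map_smul, smul_eq_mul, ContinuousLinearMap.sub_apply]
    by_cases ha : 0 ≤ a i
    · have := e1.1 ha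
      have := e2.2 (not_not.2 ha)
      rw [abs_of_nonneg ha]; nlinarith
    · have := e1.2 ha
      have := e2.1 ha
      rw [abs_of_neg (not_le.1 ha)]; nlinarith
  have hn : ‖ω - ω'‖ ≤ 2 := (norm_sub_le _ _).trans (by linarith)
  have := (le_abs_self _).trans ((ω - ω').le_opNorm (∑ i ∈ Finset.range N, a i • g i))
  nlinarith [norm_nonneg (∑ i ∈ Finset.range N, a i • g i)]

/-- Abstract Cantor scheme. -/
lemma cantor_tree {σ Ω Z : Type*} (Q : σ → Set Ω → Prop) (Hi Lo : Z → Set Ω)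
    (s₀ : σ) (L₀ : Set Ω) (h0 : Q s₀ L₀) (hne : ∀ s L, Q s L → L.Nonempty)
    (step : ∀ (s : σ) (F : Set (Set Ω)), F.Finite → (∀ L ∈ F, Q s L) →
      ∃ (e : Z) (s' : σ), ∀ L ∈ F, (∃ L', Q s' L' ∧ L' ⊆ L ∩ Hi e) ∧
        (∃ L', Q s' L' ∧ L' ⊆ L ∩ Lo e)) :
    ∃ e : ℕ → Z, ∀ (N : ℕ) (θ : ℕ → Prop), ∃ ω : Ω, ∀ i < N,
      (θ i → ω ∈ Hi (e i)) ∧ (¬ θ i → ω ∈ Lo (e i)) := by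
  classical
  let St := {p : σ × Set (Set Ω) // p.2.Finite ∧ ∀ L ∈ p.2, Q p.1 L}
  have step' : ∀ p : St, ∃ (e : Z) (q : St), ∀ L ∈ p.1.2, (∃ L' ∈ q.1.2, L' ⊆ L ∩ Hi e) ∧
      (∃ L' ∈ q.1.2, L' ⊆ L ∩ Lo e) := by
    rintro ⟨⟨s, F⟩, hF, hQ⟩
    obtain ⟨e, s', h⟩ := step s F hF hQ
    choose! A hA using fun L hL => (h L hL).1
    choose! B hB using fun L hL => (h L hL).2
    refine ⟨e, ⟨⟨s', A '' F ∪ B '' F⟩, (hF.image _).union (hF.image _), ?_⟩, ?_⟩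
    · rintro L (⟨L', hL', rfl⟩ | ⟨L', hL', rfl⟩)
      · exact (hA L' hL').1
      · exact (hB L' hL').1
    · intro L hL
      exact ⟨⟨A L, Or.inl ⟨L, hL, rfl⟩, (hA L hL).2⟩, ⟨B L, Or.inr ⟨L, hL, rfl⟩, (hB L hL).2⟩⟩
  choose ee nx hnx using step'
  let st : ℕ → St := fun n => Nat.rec ⟨⟨s₀, {L₀}⟩, Set.finite_singleton _, by simpa using h0⟩
    (fun _ p => nx p) n
  refine ⟨fun n => ee (st n), fun N θ => ?_⟩
  have : ∃ L ∈ (st N).1.2, ∀ ω ∈ L, ∀ i < N,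
      (θ i → ω ∈ Hi (ee (st i))) ∧ (¬ θ i → ω ∈ Lo (ee (st i))) := by
    induction N with
    | zero => exact ⟨L₀, rfl, by simp⟩
    | succ N ih =>
      obtain ⟨L, hL, h⟩ := ih
      obtain ⟨⟨A, hA, hA'⟩, ⟨B, hB, hB'⟩⟩ := hnx (st N) L hL
      by_cases hθ : θ N
      · refine ⟨A, hA, fun ω hω i hi => ?_⟩
        rcases Nat.lt_succ_iff_lt_or_eq.1 hi with hi | rfl
        · exact h ω (hA' hω).1 i hi
        · exact ⟨fun _ => (hA' hω).2, fun h => absurd hθ h⟩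
      · refine ⟨B, hB, fun ω hω i hi => ?_⟩
        rcases Nat.lt_succ_iff_lt_or_eq.1 hi with hi | rfl
        · exact h ω (hB' hω).1 i hi
        · exact ⟨fun h => absurd h hθ, fun _ => (hB' hω).2⟩
  obtain ⟨L, hL, h⟩ := this
  obtain ⟨ω, hω⟩ := hne _ _ ((st N).2.2 L hL)
  exact ⟨ω, h ω hω⟩

/-- `M` converges on `L` -/
def ConvOn {Ω : Type*} (A : ℕ → Set Ω) (M : Set ℕ) (L : Set Ω) : Prop :=
  ∀ ω ∈ L, {n ∈ M | ω ∈ A n}.Finite ∨ {n ∈ M | ω ∉ A n}.Finite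

lemma rosenthal_step {Ω : Type*} (A : ℕ → Set Ω) (M : Set ℕ) (hM : M.Infinite)
    (F : Set (Set Ω)) (hF : F.Finite)
    (hQ : ∀ L ∈ F, ∀ M' ⊆ M, M'.Infinite → ¬ ConvOn A M' L) :
    ∃ (j : ℕ) (M' : Set ℕ), M' ⊆ M ∧ M'.Infinite ∧ ∀ L ∈ F, ∀ M'' ⊆ M', M''.Infinite →
      ¬ ConvOn A M'' (L ∩ A j) ∧ ¬ ConvOn A M'' (L ∩ (A j)ᶜ) := by
  classical
  by_contra hcon
  push Not at hcon
  have hcon' : ∀ (j : ℕ) (M' : Set ℕ), M' ⊆ M → M'.Infinite → ∃ L ∈ F, ∃ b : Bool,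
      ∃ M'' ⊆ M', M''.Infinite ∧ ConvOn A M'' (L ∩ (if b then A j else (A j)ᶜ)) := by
    intro j M' h1 h2
    obtain ⟨L, hL, M'', h3, h4, h5⟩ := hcon j M' h1 h2
    by_cases h6 : ConvOn A M'' (L ∩ A j)
    · exact ⟨L, hL, true, M'', h3, h4, by simpa using h6⟩
    · exact ⟨L, hL, false, M'', h3, h4, by simpa using h5 h6⟩
  let St := {p : Set ℕ // p ⊆ M ∧ p.Infinite}
  have step : ∀ p : St, ∃ (j : ℕ) (q : St) (L : F) (b : Bool), j ∈ p.1 ∧ q.1 ⊆ p.1 ∧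
      (∀ n ∈ q.1, j < n) ∧ ConvOn A q.1 (L.1 ∩ (if b then A j else (A j)ᶜ)) := by
    rintro ⟨p, hp, hp'⟩
    obtain ⟨j, hj⟩ := hp'.nonempty
    have hinf : {n ∈ p | j < n}.Infinite := by
      intro hf
      refine hp' ((hf.union (Set.finite_Iic j)).subset fun n hn => ?_)
      by_cases h : j < n
      · exact Or.inl ⟨hn, h⟩
      · exact Or.inr (not_lt.1 h)
    obtain ⟨L, hL, b, M'', h3, h4, h5⟩ := hcon' j {n ∈ p | j < n}
      (fun n hn => hp hn.1) hinf
    exact ⟨j, ⟨M'', fun n hn => hp (h3 hn).1, h4⟩, ⟨L, hL⟩, b, hj, fun n hn => (h3 hn).1,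
      fun n hn => (h3 hn).2, h5⟩
  choose jj nx LL bb h1 h2 h3 h4 using step
  let st : ℕ → St := fun n => Nat.rec ⟨M, subset_rfl, hM⟩ (fun _ p => nx p) n
  have anti : ∀ m n, m ≤ n → (st n).1 ⊆ (st m).1 := by
    intro m n hmn
    induction n, hmn using Nat.le_induction with
    | base => exact subset_rfl
    | succ n _ ih => exact (h2 (st n)).trans ih
  have hlt : ∀ m n, m < n → jj (st m) < jj (st n) := by
    intro m n hmn
    exact h3 (st m) _ (anti (m+1) n hmn (h1 (st n)))
  have hmono : StrictMono (fun n => jj (st n)) := fun m n h => hlt m n h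
  have : Finite F := hF
  obtain ⟨⟨L, b⟩, hLb⟩ := Finite.exists_infinite_fiber (fun n => (LL (st n), bb (st n)))
  set I : Set ℕ := (fun n => (LL (st n), bb (st n))) ⁻¹' {(L, b)} with hI
  have hIinf : I.Infinite := Set.infinite_coe_iff.1 hLb
  let J := (fun n => jj (st n)) '' I
  have hJ : J.Infinite := hIinf.image hmono.injective.injOn
  have hJM : J ⊆ M := by
    rintro _ ⟨n, _, rfl⟩
    exact (st n).2.1 (h1 (st n))
  refine hQ L L.2 J hJM hJ ?_
  intro ω hω
  by_cases hex : ∃ n ∈ I, ω ∈ (if b then A (jj (st n)) else (A (jj (st n)))ᶜ)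
  · obtain ⟨n, hn, hωn⟩ := hex
    have hn' : LL (st n) = L ∧ bb (st n) = b := by simpa [hI] using hn
    have hc := h4 (st n) ω (by rw [hn'.1, hn'.2]; exact ⟨hω, hωn⟩)
    have hsub : ∀ k ∈ J, k ∈ (nx (st n)).1 ∨ k ≤ jj (st n) := by
      rintro _ ⟨m, _, rfl⟩
      rcases lt_or_ge n m with h | h
      · exact Or.inl (anti (n+1) m h (h1 (st m)))
      · exact Or.inr (hmono.monotone h)
    rcases hc with hc | hc
    · left
      refine (hc.union (Set.finite_Iic (jj (st n)))).subset ?_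
      rintro k ⟨hk, hk'⟩
      rcases hsub k hk with h | h
      · exact Or.inl ⟨h, hk'⟩
      · exact Or.inr h
    · right
      refine (hc.union (Set.finite_Iic (jj (st n)))).subset ?_
      rintro k ⟨hk, hk'⟩
      rcases hsub k hk with h | h
      · exact Or.inl ⟨h, hk'⟩
      · exact Or.inr h
  · push Not at hex
    cases b
    · right
      convert Set.finite_empty
      ext k
      simp only [Set.mem_ofPred_eq, Set.mem_empty_iff_false, iff_false]
      rintro ⟨⟨n, hn, rfl⟩, hk⟩
      exact hex n hn (by simpa using hk)
    · left
      convert Set.finite_empty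
      ext k
      simp only [Set.mem_ofPred_eq, Set.mem_empty_iff_false, iff_false]
      rintro ⟨⟨n, hn, rfl⟩, hk⟩
      exact hex n hn (by simpa using hk)

lemma rosenthal_dichotomy {Ω : Type*} (A : ℕ → Set Ω) :
    (∃ M : Set ℕ, M.Infinite ∧ ConvOn A M Set.univ) ∨
    (∃ e : ℕ → ℕ, ∀ (N : ℕ) (θ : ℕ → Prop), ∃ ω : Ω, ∀ i < N,
      (θ i → ω ∈ A (e i)) ∧ (¬ θ i → ω ∈ (A (e i))ᶜ)) := by
  by_cases h : ∃ M : Set ℕ, M.Infinite ∧ ConvOn A M Set.univ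
  · exact Or.inl h
  right
  push Not at h
  refine cantor_tree (σ := {M : Set ℕ // M.Infinite})
    (fun M L => ∀ M' ⊆ M.1, M'.Infinite → ¬ ConvOn A M' L) A (fun j => (A j)ᶜ)
    ⟨Set.univ, Set.infinite_univ⟩ Set.univ (fun M' _ hM' => h M' hM') ?_ ?_
  · intro M L hL
    by_contra hne
    rw [Set.not_nonempty_iff_eq_empty] at hne
    exact hL M.1 subset_rfl M.2 (by subst hne; intro ω hω; exact absurd hω (by simp))
  · rintro ⟨M, hM⟩ F hF hQ
    obtain ⟨j, M', h1, h2, h3⟩ := rosenthal_step A M hM F hF hQ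
    exact ⟨j, ⟨M', h2⟩, fun L hL => ⟨⟨_, fun M'' hs hi => (h3 L hL M'' hs hi).1, subset_rfl⟩,
      ⟨_, fun M'' hs hi => (h3 L hL M'' hs hi).2, subset_rfl⟩⟩⟩

/-- Rosenthal's disjointification lemma. -/
lemma rosenthal_matrix (b : ℕ → ℕ → ℝ) (hb : ∀ s t, 0 ≤ b s t) (δ : ℝ) (hδ : 0 ≤ δ) (n : ℕ) :
    ∀ φ : ℕ → ℕ, Function.Injective φ →
      (∀ s (F : Finset ℕ), ∑ t ∈ F, b (φ s) (φ t) ≤ n * δ) →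
      ∃ ψ : ℕ → ℕ, Function.Injective ψ ∧
        ∀ s (F : Finset ℕ), s ∉ F → ∑ t ∈ F, b (ψ s) (ψ t) ≤ δ := by
  classical
  induction n with
  | zero =>
    intro φ hφ h
    refine ⟨φ, hφ, fun s F _ => ?_⟩
    exact (h s F).trans (by simpa using hδ)
  | succ n ih =>
    intro φ hφ h
    by_cases hg : ∃ k : ℕ, ∀ s (F : Finset ℕ), s ∉ F →
        ∑ t ∈ F, b (φ (Nat.pair k s)) (φ (Nat.pair k t)) ≤ δ
    · obtain ⟨k, hk⟩ := hg
      refine ⟨fun s => φ (Nat.pair k s), fun s t hst => ?_, hk⟩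
      exact (Nat.pair_eq_pair.1 (hφ hst)).2
    · push Not at hg
      choose s F hsF hbig using hg
      refine ih (fun k => φ (Nat.pair k (s k))) (fun k l hkl => ?_) ?_
      · exact (Nat.pair_eq_pair.1 (hφ hkl)).1
      · intro k G
        have hdis : Disjoint (G.image fun l => Nat.pair l (s l))
            ((F k).image fun t => Nat.pair k t) := by
          rw [Finset.disjoint_left]
          intro x hx hx'
          obtain ⟨l, _, rfl⟩ := Finset.mem_image.1 hx
          obtain ⟨t, ht, hlt⟩ := Finset.mem_image.1 hx'
          have := Nat.pair_eq_pair.1 hlt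
          obtain ⟨rfl, rfl⟩ := this
          exact hsF k ht
        have h1 := h (Nat.pair k (s k)) ((G.image fun l => Nat.pair l (s l)) ∪
            ((F k).image fun t => Nat.pair k t))
        rw [Finset.sum_union hdis, Finset.sum_image, Finset.sum_image] at h1
        · have := hbig k
          push_cast at h1
          linarith
        · intro t _ t' _ hh
          exact (Nat.pair_eq_pair.1 hh).2
        · intro t _ t' _ hh
          exact (Nat.pair_eq_pair.1 hh).1

/-- The dual unit ball with the weak-star topology. -/
def wBall (E : Type*) [NormedAddCommGroup E] [NormedSpace ℝ E] : Set (WeakDual ℝ E) :=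
  WeakDual.toStrongDual ⁻¹' closedBall (0 : StrongDual ℝ E) 1

section partB
variable {E : Type*} [NormedAddCommGroup E] [NormedSpace ℝ E]

lemma mem_wBall (y : WeakDual ℝ E) : y ∈ wBall E ↔ ‖WeakDual.toStrongDual y‖ ≤ 1 := by
  simp [wBall]

lemma wBall_compact : IsCompact (wBall E) := WeakDual.isCompact_closedBall _ _

lemma wBall_convex : Convex ℝ (wBall E) := by
  have := (convex_closedBall (0 : StrongDual ℝ E) 1).linear_preimage
    (WeakDual.toStrongDual (𝕜 := ℝ) (E := E)).toLinearMap
  exact this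

lemma wd_lcs : LocallyConvexSpace ℝ (WeakDual ℝ E) :=
  inferInstanceAs (LocallyConvexSpace ℝ (WeakBilin (topDualPairing ℝ E)))

lemma compact_convexJoin {V : Type*} [AddCommGroup V] [Module ℝ V] [TopologicalSpace V]
    [IsTopologicalAddGroup V] [ContinuousSMul ℝ V] {s t : Set V} (hs : IsCompact s)
    (ht : IsCompact t) : IsCompact (convexJoin ℝ s t) := by
  have h : convexJoin ℝ s t =
      (fun p : (V × V) × ℝ => (1 - p.2) • p.1.1 + p.2 • p.1.2) '' ((s ×ˢ t) ×ˢ Set.Icc (0:ℝ) 1) := by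
    ext z
    simp only [mem_convexJoin, segment_eq_image, Set.mem_image, Set.mem_prod, Prod.exists]
    constructor
    · rintro ⟨a, ha, b, hb, θ, hθ, rfl⟩
      exact ⟨a, b, θ, ⟨⟨ha, hb⟩, hθ⟩, rfl⟩
    · rintro ⟨a, b, θ, ⟨⟨ha, hb⟩, hθ⟩, rfl⟩
      exact ⟨a, ha, b, hb, θ, hθ, rfl⟩
  rw [h]
  exact ((hs.prod ht).prod isCompact_Icc).image (by fun_prop)

lemma weval_cont (x : E) : Continuous (fun y : WeakDual ℝ E => y x) :=
  WeakBilin.eval_continuous (topDualPairing ℝ E) x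

/-- Choquet's lemma. -/
lemma choquet_weak (e₀ : WeakDual ℝ E) (he : e₀ ∈ (wBall E).extremePoints ℝ)
    (U : Set (WeakDual ℝ E)) (hU : U ∈ 𝓝 e₀) :
    ∃ (x : E) (c : ℝ), c < e₀ x ∧ ∀ y ∈ wBall E, c < y x → y ∈ U := by
  have := wd_lcs (E := E)
  let P : Set (WeakDual ℝ E) → Prop := fun U =>
    ∃ Q, Q ⊆ wBall E ∧ IsCompact Q ∧ Convex ℝ Q ∧ e₀ ∉ Q ∧ wBall E \ U ⊆ Q
  let G : Filter (WeakDual ℝ E) :=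
    { sets := {U | P U}
      univ_sets := ⟨∅, by simp, isCompact_empty, convex_empty, by simp, by simp⟩
      sets_of_superset := by
        rintro U V ⟨Q, h1, h2, h3, h4, h5⟩ hUV
        exact ⟨Q, h1, h2, h3, h4, fun z hz => h5 ⟨hz.1, fun h => hz.2 (hUV h)⟩⟩
      inter_sets := by
        rintro U V ⟨Q, h1, h2, h3, h4, h5⟩ ⟨R, k1, k2, k3, k4, k5⟩
        have hsub : wBall E \ (U ∩ V) ⊆ Q ∪ R := by
          rintro z ⟨hz, hz'⟩
          by_cases hzU : z ∈ U
          · right; exact k5 ⟨hz, fun h => hz' ⟨hzU, h⟩⟩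
          · left; exact h5 ⟨hz, hzU⟩
        rcases Q.eq_empty_or_nonempty with rfl | hQ
        · exact ⟨R, k1, k2, k3, k4, by simpa using hsub⟩
        rcases R.eq_empty_or_nonempty with rfl | hR
        · exact ⟨Q, h1, h2, h3, h4, by simpa using hsub⟩
        refine ⟨convexJoin ℝ Q R, ?_, compact_convexJoin h2 k2, h3.convexJoin k3, ?_, ?_⟩
        · exact convexJoin_subset h1 k1 wBall_convex
        · rw [mem_convexJoin]
          rintro ⟨a, ha, b, hb, hab⟩
          rcases (mem_extremePoints_iff_forall_segment.1 he).2 a (h1 ha) b (k1 hb) hab with h | h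
          · exact h4 (h ▸ ha)
          · exact k4 (h ▸ hb)
        · exact hsub.trans (Set.union_subset (subset_convexJoin_left hR)
            (subset_convexJoin_right hQ)) }
  have hG : G ≤ 𝓝 e₀ := by
    have : Filter.Tendsto (fun y : WeakDual ℝ E => y) G (𝓝 e₀) := by
      rw [tendsto_iff_forall_eval_tendsto_topDualPairing]
      intro x
      rw [tendsto_order]
      refine ⟨fun c hc => ?_, fun c hc => ?_⟩
      · refine ⟨wBall E ∩ {y | y x ≤ c}, Set.inter_subset_left, ?_, ?_, ?_, ?_⟩
        · exact wBall_compact.inter_right (isClosed_le (weval_cont x) continuous_const)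
        · refine wBall_convex.inter ?_
          exact convex_halfSpace_le (f := fun y : WeakDual ℝ E => y x)
            ⟨fun _ _ => rfl, fun _ _ => rfl⟩ c
        · rintro ⟨-, h⟩
          exact absurd hc (not_lt.2 h)
        · rintro z ⟨hz, hz'⟩
          exact ⟨hz, show z x ≤ c from not_lt.1 hz'⟩
      · refine ⟨wBall E ∩ {y | c ≤ y x}, Set.inter_subset_left, ?_, ?_, ?_, ?_⟩
        · exact wBall_compact.inter_right (isClosed_le continuous_const (weval_cont x))
        · refine wBall_convex.inter ?_
          exact convex_halfSpace_ge (f := fun y : WeakDual ℝ E => y x)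
            ⟨fun _ _ => rfl, fun _ _ => rfl⟩ c
        · rintro ⟨-, h⟩
          exact absurd hc (not_lt.2 h)
        · rintro z ⟨hz, hz'⟩
          exact ⟨hz, show c ≤ z x from not_lt.1 hz'⟩
    exact this
  obtain ⟨Q, -, h2, h3, h4, h5⟩ := hG hU
  obtain ⟨φ, u, hφ, hu⟩ := geometric_hahn_banach_closed_point h3 h2.isClosed h4
  obtain ⟨x, hx⟩ := LinearMap.dualEmbedding_surjective (topDualPairing ℝ E) φ
  have hx' : ∀ y : WeakDual ℝ E, φ y = y x := fun y => by rw [← hx]; rfl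
  refine ⟨x, u, by rw [← hx']; exact hu, fun y hy hyu => ?_⟩
  by_contra hyU
  have := hφ y (h5 ⟨hy, hyU⟩)
  rw [hx'] at this
  linarith

/-- Extreme points of the dual ball, as functionals. -/
def dExt (E : Type*) [NormedAddCommGroup E] [NormedSpace ℝ E] : Set (E →L[ℝ] ℝ) :=
  {e | StrongDual.toWeakDual e ∈ (wBall E).extremePoints ℝ}

lemma dExt_norm {e : E →L[ℝ] ℝ} (he : e ∈ dExt E) : ‖e‖ ≤ 1 := by
  exact (mem_wBall _).1 (extremePoints_subset he)

/-- pointwise neighbourhood filter -/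
noncomputable def pnhds (e₀ : E →L[ℝ] ℝ) : Filter (E →L[ℝ] ℝ) :=
  Filter.comap (fun e => StrongDual.toWeakDual e) (𝓝 (StrongDual.toWeakDual e₀))

lemma pnhds_tendsto (e₀ : E →L[ℝ] ℝ) (x : E) :
    Filter.Tendsto (fun e : E →L[ℝ] ℝ => e x) (pnhds e₀) (𝓝 (e₀ x)) := by
  have h := ((weval_cont x).tendsto (StrongDual.toWeakDual e₀)).comp
    (Filter.tendsto_comap (f := fun e : E →L[ℝ] ℝ => StrongDual.toWeakDual e))
  exact h

lemma choquet {e₀ : E →L[ℝ] ℝ} (he : e₀ ∈ dExt E) {U : Set (E →L[ℝ] ℝ)} (hU : U ∈ pnhds e₀) :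
    ∃ (x : E) (c : ℝ), c < e₀ x ∧ ∀ y : E →L[ℝ] ℝ, ‖y‖ ≤ 1 → c < y x → y ∈ U := by
  obtain ⟨W, hW, hWU⟩ := hU
  obtain ⟨x, c, h1, h2⟩ := choquet_weak _ he W hW
  exact ⟨x, c, h1, fun y hy hyx => hWU (h2 (StrongDual.toWeakDual y) ((mem_wBall _).2 hy) hyx)⟩

lemma dExt_attain (y : E) : ∃ e ∈ dExt E, e y = ‖y‖ := by
  have := wd_lcs (E := E)
  let l : WeakDual ℝ E →L[ℝ] ℝ := WeakBilin.eval (topDualPairing ℝ E) y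
  have hl : ∀ z : WeakDual ℝ E, l z = z y := fun z => rfl
  have hexp : IsExposed ℝ (wBall E) (l.toExposed (wBall E)) :=
    ContinuousLinearMap.toExposed.isExposed
  obtain ⟨g, hg1, hg2⟩ := exists_dual_vector'' ℝ y
  have hle : ∀ z ∈ wBall E, z y ≤ ‖y‖ := by
    intro z hz
    rw [mem_wBall] at hz
    have h1 := (WeakDual.toStrongDual z).le_opNorm y
    have h2 : ‖WeakDual.toStrongDual z‖ * ‖y‖ ≤ 1 * ‖y‖ := by gcongr
    have h3 : z y ≤ ‖(WeakDual.toStrongDual z) y‖ := le_abs_self _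
    linarith
  have hgB : StrongDual.toWeakDual g ∈ wBall E := (mem_wBall _).2 hg1
  have hgy : (StrongDual.toWeakDual g) y = ‖y‖ := hg2
  have hne : (l.toExposed (wBall E)).Nonempty := by
    refine ⟨StrongDual.toWeakDual g, hgB, fun z hz => ?_⟩
    rw [hl, hl, hgy]
    exact hle z hz
  obtain ⟨e, he⟩ := (hexp.isCompact wBall_compact).extremePoints_nonempty hne
  have he2 := hexp.isExtreme.extremePoints_subset_extremePoints he
  have he3 := he.1
  refine ⟨WeakDual.toStrongDual e, he2, ?_⟩
  have := he3.2 _ hgB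
  rw [hl, hl, hgy] at this
  exact le_antisymm (hle e he3.1) this

lemma dExt_infinite (hinf : ¬ FiniteDimensional ℝ E) : (dExt E).Infinite := by
  have := wd_lcs (E := E)
  intro hfin
  apply hinf
  have hfin' : ((wBall E).extremePoints ℝ).Finite := by
    refine (hfin.image (fun e => StrongDual.toWeakDual e)).subset ?_
    intro z hz
    exact ⟨WeakDual.toStrongDual z, hz, rfl⟩
  let W : Submodule ℝ (E →L[ℝ] ℝ) := Submodule.span ℝ (dExt E)
  have : FiniteDimensional ℝ W := FiniteDimensional.span_of_finite ℝ hfin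
  have hB : wBall E ⊆ {z | WeakDual.toStrongDual z ∈ W} := by
    rw [← closure_convexHull_extremePoints wBall_compact (wBall_convex (E := E))]
    have hc : IsCompact (convexHull ℝ ((wBall E).extremePoints ℝ)) := hfin'.isCompact_convexHull ℝ
    rw [hc.isClosed.closure_eq]
    refine convexHull_min ?_ ?_
    · intro z hz
      have hz' : WeakDual.toStrongDual z ∈ dExt E := hz
      have hsub : dExt E ⊆ W := Submodule.subset_span
      exact hsub hz'
    · intro a ha b hb s t _ _ _
      exact W.add_mem (W.smul_mem s ha) (W.smul_mem t hb)
  have hW : W = ⊤ := by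
    rw [eq_top_iff]
    intro f _
    by_cases hf : f = 0
    · rw [hf]; exact W.zero_mem
    have hn : ‖f‖ ≠ 0 := norm_ne_zero_iff.2 hf
    have h1 : (‖f‖⁻¹ • f) ∈ W := by
      refine hB (a := StrongDual.toWeakDual (‖f‖⁻¹ • f)) ((mem_wBall _).2 ?_)
      change ‖‖f‖⁻¹ • f‖ ≤ 1
      rw [norm_smul, norm_inv, norm_norm, inv_mul_cancel₀ hn]
    have h2 := W.smul_mem ‖f‖ h1
    rwa [smul_smul, mul_inv_cancel₀ hn, one_smul] at h2
  have : FiniteDimensional ℝ (StrongDual ℝ E) := by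
    rw [hW] at this
    exact Module.Finite.equiv (Submodule.topEquiv (R := ℝ) (M := (E →L[ℝ] ℝ)))
  have : FiniteDimensional ℝ (StrongDual ℝ (StrongDual ℝ E)) := inferInstance
  exact Module.Finite.of_injective
    (NormedSpace.inclusionInDoubleDualLi (E := E) ℝ).toLinearMap
    (NormedSpace.inclusionInDoubleDualLi (E := E) ℝ).injective
end partB

section partC
variable {X : Type*} [NormedAddCommGroup X] [NormedSpace ℝ X]

/-- Slices of the unit ball. -/
def slc (f : X →L[ℝ] ℝ) (c : ℝ) : Set X := {x | ‖x‖ ≤ 1 ∧ c < f x}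

/-- Nonempty slices of the unit ball. -/
def IsSlc (S : Set X) : Prop := ∃ f c, S = slc f c ∧ S.Nonempty

lemma ball_le {f : X →L[ℝ] ℝ} {x : X} (hx : ‖x‖ ≤ 1) : |f x| ≤ ‖f‖ := by
  have := f.le_opNorm x
  rw [Real.norm_eq_abs] at this
  nlinarith [norm_nonneg f]

lemma ball_le_one {f : X →L[ℝ] ℝ} (hf : ‖f‖ ≤ 1) {x : X} (hx : ‖x‖ ≤ 1) : |f x| ≤ 1 :=
  (ball_le hx).trans hf

lemma exists_deep (f : X →L[ℝ] ℝ) (r : ℝ) (hr : r < ‖f‖) : ∃ x, ‖x‖ ≤ 1 ∧ r < f x := by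
  obtain ⟨x, hx, hx2⟩ := f.exists_lt_apply_of_lt_opNorm hr
  rw [Real.norm_eq_abs] at hx2
  rcases lt_abs.1 hx2 with h | h
  · exact ⟨x, hx.le, h⟩
  · exact ⟨-x, by simpa using hx.le, by simpa using h⟩

lemma sub_plus (f : X →L[ℝ] ℝ) (c : ℝ) (hne : (slc f c).Nonempty) (r : ℝ) (hr : r < 1) :
    ∃ S'' : Set X, IsSlc S'' ∧ S'' ⊆ slc f c ∧ ∃ ε > 0, ∀ e : X →L[ℝ] ℝ, ‖e‖ ≤ 1 →
      (∃ x ∈ S'', 1 - ε < e x) → ∃ L, IsSlc L ∧ L ⊆ slc f c ∩ {x | r ≤ e x} := by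
  obtain ⟨x₀, hx₀, hcx⟩ := hne
  set c' := (c + f x₀) / 2 with hc'
  set t := (1 - r) / (4 * (‖f‖ + 1)) with ht
  have hfn := norm_nonneg f
  have ht0 : 0 < t := by rw [ht]; apply div_pos <;> linarith
  have htt : 4 * t * (‖f‖ + 1) = 1 - r := by rw [ht]; field_simp
  set ε := min (t * (c' - c)) ((1 - r) / 2) / 2 with hε
  have hcc : 0 < c' - c := by rw [hc']; linarith
  have hε0 : 0 < ε := by
    rw [hε]; apply half_pos; apply lt_min
    · positivity
    · linarith
  have h1 : 2 * ε ≤ t * (c' - c) := by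
    have := min_le_left (t * (c' - c)) ((1 - r) / 2); rw [hε]; linarith
  have h2 : 2 * ε ≤ (1 - r) / 2 := by
    have := min_le_right (t * (c' - c)) ((1 - r) / 2); rw [hε]; linarith
  refine ⟨slc f c', ⟨f, c', rfl, x₀, hx₀, by rw [hc']; linarith⟩, fun x hx => ⟨hx.1, by
    have := hx.2; linarith⟩, ε, hε0, ?_⟩
  rintro e he ⟨x₁, ⟨hx1, hx1c⟩, hx1e⟩
  refine ⟨slc (e + t • f) ((e + t • f) x₁ - ε), ⟨_, _, rfl, x₁, hx1, by linarith⟩, ?_⟩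
  rintro y ⟨hy, hy2⟩
  simp only [add_apply, smul_apply, smul_eq_mul] at hy2
  have he1 := (abs_le.1 (ball_le_one he hy)).2
  have hf1 := (abs_le.1 (ball_le (f := f) hy)).2
  have hf2 := (abs_le.1 (ball_le (f := f) hx1)).1
  refine ⟨⟨hy, ?_⟩, ?_⟩
  · have : t * c < t * f y := by nlinarith
    exact lt_of_mul_lt_mul_left this ht0.le
  · change r ≤ e y
    nlinarith

lemma sub_minus (f : X →L[ℝ] ℝ) (c : ℝ) (hne : (slc f c).Nonempty) (ρ r : ℝ) (hr : ρ < r) :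
    ∃ x₀ ∈ slc f c, ∃ ε > 0, ∀ e : X →L[ℝ] ℝ, ‖e‖ ≤ 1 →
      e x₀ < ρ + ε → ∃ L, IsSlc L ∧ L ⊆ slc f c ∩ {x | e x ≤ r} := by
  obtain ⟨x', hx', hcx⟩ := hne
  have hgap : 0 < ‖f‖ - c := by
    have := (abs_le.1 (ball_le (f := f) hx')).2; linarith
  set g := ‖f‖ - c with hg
  set t := g / 8 with ht
  set η := (r - ρ) / 4 with hη
  set τ := min (t * η) (g / 4) with hτ
  have ht0 : 0 < t := by rw [ht]; linarith
  have hη0 : 0 < η := by rw [hη]; linarith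
  have hτ0 : 0 < τ := by rw [hτ]; apply lt_min <;> [positivity; linarith]
  have h1 : τ ≤ t * η := min_le_left _ _
  have h2 : τ ≤ g / 4 := min_le_right _ _
  obtain ⟨x₀, hx0, hx0f⟩ := exists_deep f (‖f‖ - τ) (by linarith)
  refine ⟨x₀, ⟨hx0, by linarith⟩, η, hη0, ?_⟩
  intro e he hex
  refine ⟨slc (f - t • e) ((f - t • e) x₀ - τ), ⟨_, _, rfl, x₀, hx0, by linarith⟩, ?_⟩
  rintro y ⟨hy, hy2⟩
  simp only [sub_apply, smul_apply, smul_eq_mul] at hy2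
  have he1 := (abs_le.1 (ball_le_one he hy)).1
  have he2 := (abs_le.1 (ball_le_one he hx0)).2
  have hf1 := (abs_le.1 (ball_le (f := f) hy)).2
  refine ⟨⟨hy, ?_⟩, ?_⟩
  · nlinarith
  · change e y ≤ r
    have : t * e y < t * (ρ + η + 2 * η) := by nlinarith
    have := lt_of_mul_lt_mul_left this ht0.le
    linarith

lemma tree_lemma (F : Filter (X →L[ℝ] ℝ)) [F.NeBot] (hB : ∀ᶠ e in F, ‖e‖ ≤ 1) (k : X → ℝ)
    (hk : ∀ x, Filter.Tendsto (fun e : X →L[ℝ] ℝ => e x) F (𝓝 (k x))) (S₀ : Set X)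
    (hS₀ : IsSlc S₀) (ρ : ℝ) (hρ : ρ < 1) (hkρ : ∀ x ∈ S₀, k x ≤ ρ)
    (hit : ∀ S : Set X, IsSlc S → S ⊆ S₀ → ∀ ε > 0, ∀ᶠ e in F, ∃ x ∈ S, 1 - ε < e x) :
    ContainsCopyOfL1 (X →L[ℝ] ℝ) := by
  set δ := (1 - ρ) / 4 with hδ
  have hδ0 : 0 < δ := by rw [hδ]; linarith
  set r := ρ + δ with hr
  obtain ⟨e, he⟩ := cantor_tree (σ := Unit) (Ω := X) (Z := {e : X →L[ℝ] ℝ // ‖e‖ ≤ 1})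
    (fun _ L => IsSlc L ∧ L ⊆ S₀) (fun e => {x | ‖x‖ ≤ 1 ∧ r + δ ≤ e.1 x})
    (fun e => {x | ‖x‖ ≤ 1 ∧ e.1 x ≤ r})
    () S₀ ⟨hS₀, subset_rfl⟩ (fun _ L hL => by obtain ⟨⟨_, _, _, h⟩, _⟩ := hL; exact h) (by
      intro _ 𝓕 hfin hQ
      have hev : ∀ L ∈ 𝓕, ∀ᶠ e in F, ∀ he : ‖e‖ ≤ 1,
          (∃ L', (IsSlc L' ∧ L' ⊆ S₀) ∧ L' ⊆ L ∩ {x | ‖x‖ ≤ 1 ∧ r + δ ≤ e x}) ∧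
          (∃ L', (IsSlc L' ∧ L' ⊆ S₀) ∧ L' ⊆ L ∩ {x | ‖x‖ ≤ 1 ∧ e x ≤ r}) := by
        intro L hL
        obtain ⟨⟨f, c, rfl, hne⟩, hLS⟩ := hQ L hL
        obtain ⟨S'', h1, h2, ε, hε, h3⟩ := sub_plus f c hne (r + δ) (by rw [hr]; linarith)
        obtain ⟨x₀, g1, ε', hε', g3⟩ := sub_minus f c hne ρ r (by rw [hr]; linarith)
        have hlt : k x₀ < ρ + ε' := by linarith [hkρ x₀ (hLS g1)]
        filter_upwards [hit S'' h1 (h2.trans hLS) ε hε, (hk x₀).eventually_lt_const hlt]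
          with e he1 he2 he
        obtain ⟨L1, a1, a2⟩ := h3 e he he1
        obtain ⟨L2, b1, b2⟩ := g3 e he he2
        exact ⟨⟨L1, ⟨a1, fun x hx => hLS (a2 hx).1⟩,
            fun x hx => ⟨(a2 hx).1, (a2 hx).1.1, (a2 hx).2⟩⟩,
          ⟨L2, ⟨b1, fun x hx => hLS (b2 hx).1⟩, fun x hx => ⟨(b2 hx).1, (b2 hx).1.1, (b2 hx).2⟩⟩⟩
      have hev2 := (Filter.eventually_all_finite hfin).2 hev
      obtain ⟨e, he1, he2⟩ := (hB.and hev2).exists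
      exact ⟨⟨e, he1⟩, (), fun L hL => he2 L hL he1⟩)
  refine l1_of_indep (fun n => (e n).1) (fun n => (e n).2) r δ hδ0 ?_
  intro N θ
  obtain ⟨x, hx⟩ := he (N + 1) θ
  have hxn : ‖x‖ ≤ 1 := by
    by_cases h : θ 0
    · exact ((hx 0 (by omega)).1 h).1
    · exact ((hx 0 (by omega)).2 h).1
  refine ⟨NormedSpace.inclusionInDoubleDual ℝ X x, ?_, fun i hi => ?_⟩
  · exact (NormedSpace.double_dual_bound ℝ X x).trans hxn
  · have := hx i (by omega)
    exact ⟨fun h => (this.1 h).2, fun h => (this.2 h).2⟩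

lemma norm_slice {E : Type*} [NormedAddCommGroup E] [NormedSpace ℝ E] [Nontrivial E] (x₀ : E)
    (c : ℝ) (hc : c < ‖x₀‖) : ∃ u : E, ∃ c' : ℝ, ‖u‖ = 1 ∧ c' < 1 ∧
      ∀ y : E →ₗ[ℝ] ℝ, c' < y u → c < y x₀ := by
  by_cases h : x₀ = 0
  · obtain ⟨u, hu⟩ := exists_norm_eq E (zero_le_one' ℝ)
    exact ⟨u, 0, hu, one_pos, fun y _ => by rw [h]; simpa [h] using hc⟩
  · have hn : 0 < ‖x₀‖ := norm_pos_iff.2 h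
    refine ⟨‖x₀‖⁻¹ • x₀, c / ‖x₀‖, ?_, (div_lt_one hn).2 hc, fun y hy => ?_⟩
    · rw [norm_smul, norm_inv, norm_norm, inv_mul_cancel₀ hn.ne']
    · rw [map_smul, smul_eq_mul, inv_mul_eq_div] at hy
      exact (div_lt_div_iff_of_pos_right hn).1 hy

lemma adp_slice [Nontrivial X] (hADP : RealAlternativeDaugavetProperty X) (x₀ : X) (c : ℝ)
    (hne : ∃ y : X →L[ℝ] ℝ, ‖y‖ ≤ 1 ∧ c < y x₀) (S : Set X) (hS : IsSlc S) (ε : ℝ) (hε : 0 < ε) :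
    ∃ (x₁ : X) (c₁ : ℝ), (∃ y : X →L[ℝ] ℝ, ‖y‖ ≤ 1 ∧ c₁ < y x₁) ∧ ∀ y : X →L[ℝ] ℝ, ‖y‖ ≤ 1 →
      c₁ < y x₁ → c < y x₀ ∧ ∃ x ∈ S, 1 - ε < |y x| := by
  obtain ⟨y₀, hy₀, hcy⟩ := hne
  have hc : c < ‖x₀‖ := by
    have h1 := y₀.le_opNorm x₀
    have h2 := le_abs_self (y₀ x₀)
    rw [Real.norm_eq_abs] at h1
    nlinarith [norm_nonneg x₀]
  obtain ⟨f₀, d₀, rfl, z, hz, hzd⟩ := hS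
  have hd : d₀ < ‖f₀‖ := by
    have := (abs_le.1 (ball_le (f := f₀) hz)).2; linarith
  obtain ⟨u, c', hu, hc', hux⟩ := norm_slice x₀ c hc
  obtain ⟨f, d, hf, hd', hfd⟩ := norm_slice f₀ d₀ hd
  set τ := min (min ((1 - c') / 2) (ε / 2)) (1 - d) with hτ
  have hτ0 : 0 < τ := by
    rw [hτ]; refine lt_min (lt_min ?_ ?_) ?_ <;> linarith
  have h1 : τ ≤ (1 - c') / 2 := (min_le_left _ _).trans (min_le_left _ _)
  have h2 : τ ≤ ε / 2 := (min_le_left _ _).trans (min_le_right _ _)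
  have h3 : τ ≤ 1 - d := min_le_right _ _
  have hT : ‖f.smulRight u‖ = 1 := by rw [ContinuousLinearMap.norm_smulRight_apply, hf, hu, one_mul]
  have hmax := hADP f u
  rw [hT] at hmax
  have key : ∃ σ : ℝ, (σ = 1 ∨ σ = -1) ∧
      ‖ContinuousLinearMap.id ℝ X + σ • f.smulRight u‖ = 2 := by
    rcases max_choice ‖ContinuousLinearMap.id ℝ X + f.smulRight u‖
        ‖ContinuousLinearMap.id ℝ X - f.smulRight u‖ with h | h
    · refine ⟨1, Or.inl rfl, ?_⟩
      rw [one_smul, ← h, hmax]; norm_num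
    · refine ⟨-1, Or.inr rfl, ?_⟩
      rw [neg_one_smul, ← sub_eq_add_neg, ← h, hmax]; norm_num
  obtain ⟨σ, hσ, hσn⟩ := key
  have hσabs : |σ| = 1 := by rcases hσ with rfl | rfl <;> simp
  have hσsq : σ * σ = 1 := by rcases hσ with rfl | rfl <;> norm_num
  have key2 : ∃ x : X, ‖x‖ ≤ 1 ∧ 2 - τ < ‖x + (σ * f x) • u‖ ∧ 0 ≤ f x := by
    obtain ⟨x, hx, hx2⟩ := ContinuousLinearMap.exists_lt_apply_of_lt_opNorm
      (ContinuousLinearMap.id ℝ X + σ • f.smulRight u) (r := 2 - τ) (by linarith)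
    have hx3 : 2 - τ < ‖x + (σ * f x) • u‖ := by
      simpa [smul_smul] using hx2
    rcases le_total 0 (f x) with h | h
    · exact ⟨x, hx.le, hx3, h⟩
    · refine ⟨-x, by simpa using hx.le, ?_, by simpa using h⟩
      have : -x + (σ * f (-x)) • u = -(x + (σ * f x) • u) := by
        rw [map_neg]; module
      rw [this, norm_neg]; exact hx3
  obtain ⟨x, hx, hx2, hfx⟩ := key2
  have hfx1 : f x ≤ 1 := (abs_le.1 (ball_le_one hf.le hx)).2
  have hfx2 : 1 - τ < f x := by
    have a1 := norm_add_le x ((σ * f x) • u)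
    rw [norm_smul, hu, Real.norm_eq_abs, abs_mul, hσabs, abs_of_nonneg hfx] at a1
    linarith
  have hw : 2 - 2 * τ < ‖u + σ • x‖ := by
    have a0 : ‖u + σ • x‖ = ‖x + σ • u‖ := by
      have : u + σ • x = σ • (x + σ • u) := by
        rw [smul_add, smul_smul, hσsq, one_smul, add_comm]
      rw [this, norm_smul, Real.norm_eq_abs, hσabs, one_mul]
    have a1 : x + (σ * f x) • u = (x + σ • u) + (σ * (f x - 1)) • u := by module
    have a2 := norm_add_le (x + σ • u) ((σ * (f x - 1)) • u)
    rw [← a1, norm_smul, hu, Real.norm_eq_abs, abs_mul, hσabs,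
      abs_of_nonpos (by linarith : f x - 1 ≤ 0)] at a2
    linarith
  refine ⟨u + σ • x, 2 - 2 * τ, ?_, ?_⟩
  · obtain ⟨g, hg1, hg2⟩ := exists_dual_vector'' ℝ (u + σ • x)
    exact ⟨g, hg1, by rw [hg2]; exact hw⟩
  · intro y hy hyw
    rw [map_add, map_smul, smul_eq_mul] at hyw
    have b1 := (abs_le.1 (ball_le_one hy hu.le)).2
    have b2 : |σ * y x| = |y x| := by rw [abs_mul, hσabs, one_mul]
    have b3 := ball_le_one hy hx
    have b4 := le_abs_self (σ * y x)
    refine ⟨?_, x, ⟨hx, ?_⟩, by linarith⟩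
    · exact hux y.toLinearMap (show c' < y u by linarith)
    · exact hfd (ContinuousLinearMap.apply ℝ ℝ x).toLinearMap (show d < f x by linarith)

/-- functionals almost norming on a slice -/
def dSet (p : Set X × ℝ) : Set (X →L[ℝ] ℝ) := {y | ∃ x ∈ p.1, 1 - p.2 < |y x|}

lemma adp_slices [Nontrivial X] (hADP : RealAlternativeDaugavetProperty X)
    (𝒯 : Set (Set (X →L[ℝ] ℝ))) (hfin : 𝒯.Finite) :
    (𝒯 ⊆ dSet '' {p : Set X × ℝ | IsSlc p.1 ∧ 0 < p.2}) → ∀ (x₀ : X) (c : ℝ)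
    (_ : ∃ y : X →L[ℝ] ℝ, ‖y‖ ≤ 1 ∧ c < y x₀),
    ∃ (x₁ : X) (c₁ : ℝ), (∃ y : X →L[ℝ] ℝ, ‖y‖ ≤ 1 ∧ c₁ < y x₁) ∧ ∀ y : X →L[ℝ] ℝ, ‖y‖ ≤ 1 →
      c₁ < y x₁ → c < y x₀ ∧ y ∈ ⋂₀ 𝒯 := by
  induction 𝒯, hfin using Set.Finite.induction_on with
  | empty => intro _ x₀ c h; exact ⟨x₀, c, h, fun y _ hy => ⟨hy, by simp⟩⟩
  | insert _ _ ih =>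
    intro hsub x₀ c h
    rw [Set.insert_subset_iff] at hsub
    obtain ⟨⟨p, ⟨hp1, hp2⟩, rfl⟩, hsub2⟩ := hsub
    obtain ⟨x₁, c₁, h1, h2⟩ := ih hsub2 x₀ c h
    obtain ⟨x₂, c₂, k1, k2⟩ := adp_slice hADP x₁ c₁ h1 p.1 hp1 p.2 hp2
    refine ⟨x₂, c₂, k1, fun y hy hyx => ?_⟩
    obtain ⟨l1, l2⟩ := k2 y hy hyx
    obtain ⟨l3, l4⟩ := h2 y hy l1
    exact ⟨l3, by rw [Set.sInter_insert]; exact ⟨l2, l4⟩⟩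

lemma ext_filter [Nontrivial X] (hADP : RealAlternativeDaugavetProperty X) (e₀ : X →L[ℝ] ℝ)
    (he₀ : e₀ ∈ dExt X) : ∃ F : Filter (X →L[ℝ] ℝ), F.NeBot ∧ (∀ᶠ e in F, ‖e‖ ≤ 1) ∧
      (∀ x, Filter.Tendsto (fun e : X →L[ℝ] ℝ => e x) F (𝓝 (e₀ x))) ∧
      ∀ S, IsSlc S → ∀ ε > 0, ∀ᶠ e in F, ∃ x ∈ S, 1 - ε < |e x| := by
  set 𝒟 := dSet '' {p : Set X × ℝ | IsSlc p.1 ∧ 0 < p.2} with h𝒟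
  refine ⟨pnhds e₀ ⊓ (Filter.principal {e | ‖e‖ ≤ 1} ⊓ Filter.generate 𝒟), ?_, ?_, ?_, ?_⟩
  · rw [Filter.inf_neBot_iff]
    intro s hs t ht
    rw [Filter.mem_inf_iff_superset] at ht
    obtain ⟨t1, ht1, t2, ht2, ht⟩ := ht
    rw [Filter.mem_generate_iff] at ht2
    obtain ⟨𝒯, h1, h2, h3⟩ := ht2
    obtain ⟨x, c, hc, hx⟩ := choquet he₀ hs
    obtain ⟨x₁, c₁, ⟨y, hy, hyc⟩, h⟩ := adp_slices hADP 𝒯 h2 h1 x c ⟨e₀, dExt_norm he₀, hc⟩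
    obtain ⟨k1, k2⟩ := h y hy hyc
    exact ⟨y, hx y hy k1, ht ⟨ht1 hy, h3 k2⟩⟩
  · exact Filter.mem_inf_of_right (Filter.mem_inf_of_left (Filter.mem_principal_self _))
  · intro x
    exact (pnhds_tendsto e₀ x).mono_left inf_le_left
  · intro S hS ε hε
    exact Filter.mem_inf_of_right (Filter.mem_inf_of_right
      (Filter.mem_generate_of_mem ⟨(S, ε), ⟨hS, hε⟩, rfl⟩))

lemma ext_spear [Nontrivial X] (hADP : RealAlternativeDaugavetProperty X)
    (hno : ¬ ContainsCopyOfL1 (X →L[ℝ] ℝ)) (e₀ : X →L[ℝ] ℝ) (he₀ : e₀ ∈ dExt X) (S₀ : Set X)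
    (hS₀ : IsSlc S₀) (ε : ℝ) (hε : 0 < ε) : ∃ x ∈ S₀, 1 - ε < |e₀ x| := by
  by_contra hcon
  push Not at hcon
  apply hno
  obtain ⟨F, hF, hF1, hF2, hF3⟩ := ext_filter hADP e₀ he₀
  by_cases hB : ∀ S : Set X, IsSlc S → S ⊆ S₀ → ∀ ε > 0, ∀ᶠ e in F, ∃ x ∈ S, 1 - ε < e x
  · exact tree_lemma F hF1 e₀ hF2 S₀ hS₀ (1 - ε) (by linarith)
      (fun x hx => (le_abs_self _).trans (hcon x hx)) hB
  · push Not at hB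
    obtain ⟨S₁, hS1, hS10, ε₁, hε1, hfr⟩ := hB
    have hne : (F ⊓ Filter.principal {e : X →L[ℝ] ℝ | ∀ x ∈ S₁, e x ≤ 1 - ε₁}).NeBot :=
      Filter.frequently_mem_iff_neBot.1 hfr
    refine tree_lemma (Filter.map (fun e => -e)
      (F ⊓ Filter.principal {e : X →L[ℝ] ℝ | ∀ x ∈ S₁, e x ≤ 1 - ε₁})) ?_ (fun x => - e₀ x) ?_ S₁ hS1
      (1 - ε) (by linarith) (fun x hx => (neg_le_abs _).trans (hcon x (hS10 hx))) ?_
    · rw [Filter.eventually_map]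
      refine Filter.Eventually.filter_mono inf_le_left ?_
      simpa using hF1
    · intro x
      rw [Filter.tendsto_map'_iff]
      exact ((hF2 x).mono_left inf_le_left).neg
    · intro S hS hSS ε' hε'
      rw [Filter.eventually_map]
      have h1 := (hF3 S hS (min ε' ε₁) (lt_min hε' hε1)).filter_mono
        (inf_le_left (b := Filter.principal {e : X →L[ℝ] ℝ | ∀ x ∈ S₁, e x ≤ 1 - ε₁}))
      have h2 : ∀ᶠ e in (F ⊓ Filter.principal {e : X →L[ℝ] ℝ | ∀ x ∈ S₁, e x ≤ 1 - ε₁}),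
          ∀ x ∈ S₁, e x ≤ 1 - ε₁ := Filter.mem_inf_of_right (Filter.mem_principal_self _)
      filter_upwards [h1, h2] with e ⟨x, hx, hxe⟩ h
      refine ⟨x, hx, ?_⟩
      have a1 := h x (hSS hx)
      have a2 := min_le_left ε' ε₁
      have a3 := min_le_right ε' ε₁
      rw [neg_apply]
      rcases lt_abs.1 hxe with h' | h' <;> linarith
end partC

section partD
variable {X : Type*} [NormedAddCommGroup X] [NormedSpace ℝ X]

lemma wuc_functional (v : ℕ → X →L[ℝ] ℝ)
    (hv : ∀ (F : Finset ℕ) (x : X), ∑ t ∈ F, |v t x| ≤ ‖x‖) (r : ℕ → ℝ) (hr : ∀ t, |r t| ≤ 1) :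
    ∃ G : X →L[ℝ] ℝ, ‖G‖ ≤ 1 ∧ ∀ x, HasSum (fun t => r t * v t x) (G x) := by
  have hle : ∀ x t, |r t * v t x| ≤ |v t x| := fun x t => by
    rw [abs_mul]; nlinarith [hr t, abs_nonneg (v t x)]
  have hs0 : ∀ x, Summable (fun t => |v t x|) := fun x =>
    summable_of_sum_le (fun _ => abs_nonneg _) (fun F => hv F x)
  have hs : ∀ x, Summable (fun t => r t * v t x) := fun x =>
    Summable.of_norm_bounded (hs0 x) (fun t => hle x t)
  let L : X →ₗ[ℝ] ℝ :=
    { toFun := fun x => ∑' t, r t * v t x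
      map_add' := fun x y => by
        rw [← (hs x).tsum_add (hs y)]
        exact tsum_congr (fun t => by rw [map_add]; ring)
      map_smul' := fun a x => by
        rw [RingHom.id_apply, smul_eq_mul, ← tsum_mul_left]
        exact tsum_congr (fun t => by rw [map_smul, smul_eq_mul]; ring) }
  refine ⟨L.mkContinuous 1 ?_, L.mkContinuous_norm_le zero_le_one _, fun x => (hs x).hasSum⟩
  intro x
  rw [one_mul]
  have hh := (hs x).hasSum
  refine le_of_tendsto hh.norm (Filter.Eventually.of_forall (fun F => ?_))
  exact (Finset.abs_sum_le_sum_abs _ _).trans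
    ((Finset.sum_le_sum (fun t _ => hle x t)).trans (hv F x))

lemma l1_of_wuc (w : ℕ → X →L[ℝ] ℝ) (η : ℝ) (hη : 0 < η) (hw : ∀ s, η ≤ ‖w s‖)
    (hsum : ∀ (F : Finset ℕ) (σ : ℕ → ℝ), (∀ s, σ s = 1 ∨ σ s = -1) →
      ‖∑ s ∈ F, σ s • w s‖ ≤ 1) : ContainsCopyOfL1 (X →L[ℝ] ℝ) := by
  classical
  have habs : ∀ (F : Finset ℕ) (x : X), ∑ s ∈ F, |w s x| ≤ ‖x‖ := by
    intro F x
    have h := hsum F (fun s => if 0 ≤ w s x then 1 else -1) (fun s => by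
      by_cases h : 0 ≤ w s x <;> simp [h])
    have h2 := (le_abs_self _).trans ((∑ s ∈ F, (if 0 ≤ w s x then (1:ℝ) else -1) • w s).le_opNorm x)
    have h3 : (∑ s ∈ F, (if 0 ≤ w s x then (1:ℝ) else -1) • w s) x = ∑ s ∈ F, |w s x| := by
      rw [sum_apply]
      refine Finset.sum_congr rfl (fun s _ => ?_)
      rw [smul_apply, smul_eq_mul]
      by_cases h : 0 ≤ w s x
      · rw [if_pos h, abs_of_nonneg h, one_mul]
      · rw [if_neg h, abs_of_neg (not_le.1 h)]; ring
    rw [h3] at h2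
    nlinarith [norm_nonneg x]
  choose xs hxs1 hxs2 using fun s => exists_deep (w s) (η / 2) (by linarith [hw s])
  obtain ⟨n, hn⟩ := exists_nat_ge (1 / (η / 4))
  have hn' : 1 ≤ n * (η / 4) := (div_le_iff₀ (by linarith)).1 hn
  obtain ⟨ψ, hψ, hψ2⟩ := rosenthal_matrix (fun s t => |w t (xs s)|) (fun _ _ => abs_nonneg _)
    (η / 4) (by linarith) n id Function.injective_id (fun s F =>
      (habs F (xs s)).trans ((hxs1 s).trans hn'))
  let r : ℕ → ℕ → ℝ := fun i t => if i ∈ (Denumerable.ofNat (Finset ℕ) t) then 1 else -1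
  have hr : ∀ i t, |r i t| ≤ 1 := fun i t => by
    dsimp only [r]; split_ifs <;> simp
  choose G hG1 hG2 using fun i => wuc_functional (fun t => w (ψ t)) (fun F x => by
    have := habs (F.image ψ) x
    rwa [Finset.sum_image (fun a _ b _ h => hψ h)] at this) (r i) (hr i)
  refine l1_of_seq G 1 (η / 4) hG1 (by linarith) ?_
  intro N a
  let T : Finset ℕ := (Finset.range N).filter (fun i => 0 ≤ a i)
  obtain ⟨t₀, ht0⟩ : ∃ t, Denumerable.ofNat (Finset ℕ) t = T :=
    ⟨@Encodable.encode _ Denumerable.toEncodable T, Denumerable.ofNat_encode T⟩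
  set x := xs (ψ t₀) with hx
  have hGx : ∀ i, |G i x - r i t₀ * w (ψ t₀) x| ≤ η / 4 := by
    intro i
    have h1 := ((hG2 i x).sub_const (r i t₀ * w (ψ t₀) x)).abs
    refine le_of_tendsto h1 ?_
    filter_upwards [Filter.eventually_ge_atTop {t₀}] with F hF
    have ht : t₀ ∈ F := hF (Finset.mem_singleton_self _)
    rw [← Finset.add_sum_erase F _ ht, add_sub_cancel_left]
    refine (Finset.abs_sum_le_sum_abs _ _).trans (le_trans ?_
      (hψ2 t₀ (F.erase t₀) (Finset.notMem_erase _ _)))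
    refine Finset.sum_le_sum (fun t _ => ?_)
    rw [abs_mul]
    nlinarith [hr i t, abs_nonneg (w (ψ t) x)]
  have hxx := hxs2 (ψ t₀)
  rw [← hx] at hxx
  have key : η / 4 * ∑ i ∈ Finset.range N, |a i| ≤ (∑ i ∈ Finset.range N, a i • G i) x := by
    rw [sum_apply, Finset.mul_sum]
    refine Finset.sum_le_sum (fun i hi => ?_)
    rw [smul_apply, smul_eq_mul]
    have h1 := abs_le.1 (hGx i)
    by_cases ha : 0 ≤ a i
    · have hri : r i t₀ = 1 := by
        dsimp only [r]; rw [ht0, if_pos (Finset.mem_filter.2 ⟨hi, ha⟩)]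
      rw [hri] at h1
      rw [abs_of_nonneg ha]
      nlinarith
    · have hri : r i t₀ = -1 := by
        have hnT : i ∉ T := fun h => ha (Finset.mem_filter.1 h).2
        dsimp only [r]; rw [ht0, if_neg hnT]
      rw [hri] at h1
      rw [abs_of_neg (not_le.1 ha)]
      nlinarith
  have hxn : ‖x‖ ≤ 1 := hxs1 (ψ t₀)
  exact key.trans ((le_abs_self _).trans (ball_le hxn))

/-- coefficient set -/
def Tri (a : ℝ) : Prop := a = 0 ∨ a = 1 ∨ a = -1

lemma Tri.mul {a b : ℝ} (ha : Tri a) (hb : Tri b) : Tri (a * b) := by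
  rcases ha with rfl | rfl | rfl <;> rcases hb with rfl | rfl | rfl <;> simp [Tri]

lemma wuc_construct {Z : Type*} [NormedAddCommGroup Z] [NormedSpace ℝ Z] [CompleteSpace Z]
    (Ω : Set (Z →L[ℝ] ℝ)) (hΩ1 : ∀ ω ∈ Ω, ‖ω‖ ≤ 1) (hΩ2 : ∀ y, ∃ ω ∈ Ω, ω y = ‖y‖)
    (d : ℕ → Z) (hd : ∀ n, ‖d n‖ = 2) (V : ℕ → Set (Z →L[ℝ] ℝ))
    (hV : ∀ m, V m ⊆ Ω) (hVc : ∀ ω ∈ Ω, ∃ m, ω ∈ V m)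
    (hVd : ∀ m, ∀ ω ∈ V m, ∀ n ≥ m, ω (d n) = 0) :
    ∃ w : ℕ → Z, ∃ η > 0, (∀ s, η ≤ ‖w s‖) ∧ ∀ (F : Finset ℕ) (σ : ℕ → ℝ),
      (∀ s, σ s = 1 ∨ σ s = -1) → ‖∑ s ∈ F, σ s • w s‖ ≤ 1 := by
  classical
  let r : ℕ → ℝ := fun m => 1 - 1 / ((m : ℝ) + 2)
  have hr_mono : StrictMono r := by
    intro a b hab
    have : (a : ℝ) < b := by exact_mod_cast hab
    have h1 : 1 / ((b : ℝ) + 2) < 1 / ((a : ℝ) + 2) :=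
      one_div_lt_one_div_of_lt (by positivity) (by linarith)
    dsimp only [r]; linarith
  have hr0 : ∀ m, 0 ≤ r m := fun m => by
    have h1 : 1 / ((m : ℝ) + 2) ≤ 1 := by
      rw [div_le_one (by positivity)]; have : (0:ℝ) ≤ m := Nat.cast_nonneg m; linarith
    dsimp only [r]; linarith
  have hr1 : ∀ m, r m ≤ 1 := fun m => by
    have h1 : 0 ≤ 1 / ((m : ℝ) + 2) := by positivity
    dsimp only [r]; linarith
  let G : Set Z := {y | ∀ m, ∀ ω ∈ V m, |ω y| ≤ r m}
  have hGc : IsClosed G := by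
    have : G = ⋂ m, ⋂ ω ∈ V m, {y | |ω y| ≤ r m} := by
      ext y; simp [G]
    rw [this]
    refine isClosed_iInter (fun m => isClosed_iInter (fun ω => isClosed_iInter (fun _ => ?_)))
    exact isClosed_le (by fun_prop) continuous_const
  have hG0 : (0 : Z) ∈ G := fun m ω _ => by rw [map_zero, abs_zero]; exact hr0 m
  have hGm : ∀ y ∈ G, ∃ m, ‖y‖ ≤ r m := by
    intro y hy
    obtain ⟨ω, hω, hωy⟩ := hΩ2 y
    obtain ⟨m, hm⟩ := hVc ω hω
    exact ⟨m, by rw [← hωy]; exact (le_abs_self _).trans (hy m ω hm)⟩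
  have flat : ∀ y ∈ G, ∃ a > 0, ∃ m : ℕ, ∀ y' ∈ G, ‖y' - y‖ ≤ a → ∀ n ≥ m, ∀ t : ℝ, |t| ≤ a →
      y' + t • d n ∈ G := by
    intro y hy
    obtain ⟨m, hm⟩ := hGm y hy
    have hrm := hr_mono (Nat.lt_succ_self m)
    refine ⟨(r (m + 1) - r m) / 3, by have : r m < r (m + 1) := hrm; linarith, m, ?_⟩
    intro y' hy' hyy n hn t ht p ω hω
    rw [map_add, map_smul, smul_eq_mul]
    by_cases hp : p ≤ n
    · rw [hVd p ω hω n hp, mul_zero, add_zero]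
      exact hy' p ω hω
    · have hrp : r (m + 1) ≤ r p := hr_mono.monotone (by omega)
      have b1 : |ω y'| ≤ ‖y'‖ := by
        have := ω.le_opNorm y'
        rw [Real.norm_eq_abs] at this
        nlinarith [hΩ1 ω (hV p hω), norm_nonneg y']
      have b2 : |ω (d n)| ≤ 2 := by
        have := ω.le_opNorm (d n)
        rw [Real.norm_eq_abs, hd] at this
        nlinarith [hΩ1 ω (hV p hω)]
      have b3 : ‖y'‖ ≤ ‖y‖ + ‖y' - y‖ := by
        have := norm_add_le y (y' - y); rwa [add_sub_cancel] at this
      have b4 := abs_add_le (ω y') (t * ω (d n))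
      rw [abs_mul] at b4
      have b5 : |t| * |ω (d n)| ≤ |t| * 2 := mul_le_mul_of_nonneg_left b2 (abs_nonneg _)
      linarith
  let Good : Set Z → ℕ → Prop := fun Y i =>
    ∃ n, ∀ y ∈ Y, y + ((1/2 : ℝ)^i) • d n ∈ G ∧ y - ((1/2 : ℝ)^i) • d n ∈ G
  have unif : ∀ Y : Set Z, (∃ a > 0, ∃ m : ℕ, ∀ y ∈ Y, ∀ n ≥ m, ∀ t : ℝ, |t| ≤ a →
      y + t • d n ∈ G) → ∃ i, ∀ Y' ⊆ Y, Good Y' i := by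
    rintro Y ⟨a, ha, m, h⟩
    obtain ⟨i, hi⟩ := exists_pow_lt_of_lt_one ha (by norm_num : (1/2 : ℝ) < 1)
    refine ⟨i, fun Y' hY' => ⟨m, fun y hy => ⟨h y (hY' hy) m le_rfl _ ?_, ?_⟩⟩⟩
    · rw [abs_of_nonneg (by positivity)]; exact hi.le
    · have := h y (hY' hy) m le_rfl (-(1/2 : ℝ)^i) (by
        rw [abs_neg, abs_of_nonneg (by positivity)]; exact hi.le)
      rwa [neg_smul, ← sub_eq_add_neg] at this
  have compact_unif : ∀ K : Set Z, IsCompact K → K ⊆ G → ∃ a > 0, ∃ m : ℕ, ∀ y ∈ K, ∀ n ≥ m,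
      ∀ t : ℝ, |t| ≤ a → y + t • d n ∈ G := by
    intro K hK hKG
    have hh : ∃ a > 0, ∃ m : ℕ, ∀ y ∈ K, y ∈ G → ∀ n ≥ m, ∀ t : ℝ, |t| ≤ a → y + t • d n ∈ G := by
      refine hK.induction_on (p := fun s => ∃ a > 0, ∃ m : ℕ, ∀ y ∈ s, y ∈ G → ∀ n ≥ m, ∀ t : ℝ,
        |t| ≤ a → y + t • d n ∈ G) ?_ ?_ ?_ ?_
      · exact ⟨1, one_pos, 0, fun y hy => absurd hy (Set.notMem_empty y)⟩
      · rintro s t hst ⟨a, ha, m, h⟩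
        exact ⟨a, ha, m, fun y hy => h y (hst hy)⟩
      · rintro s t ⟨a, ha, m, h⟩ ⟨a', ha', m', h'⟩
        refine ⟨min a a', lt_min ha ha', max m m', ?_⟩
        rintro y (hy | hy) hyG n hn τ hτ
        · exact h y hy hyG n (le_trans (le_max_left _ _) hn) τ (hτ.trans (min_le_left _ _))
        · exact h' y hy hyG n (le_trans (le_max_right _ _) hn) τ (hτ.trans (min_le_right _ _))
      · intro y hy
        obtain ⟨a, ha, m, h⟩ := flat y (hKG hy)
        refine ⟨closedBall y a, mem_nhdsWithin_of_mem_nhds (closedBall_mem_nhds y ha), a, ha, m, ?_⟩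
        intro y' hy' hG'
        exact h y' hG' (mem_closedBall_iff_norm.1 hy')
    obtain ⟨a, ha, m, h⟩ := hh
    exact ⟨a, ha, m, fun y hy => h y hy (hKG hy)⟩
  let St := {Y : Set Z // Y.Finite ∧ Y ⊆ G}
  have step : ∀ p : St, ∃ (q : St) (z : Z) (i : ℕ), ‖z‖ = (1/2 : ℝ)^i * 2 ∧
      (∀ j, Good p.1 j → i ≤ j) ∧ q.1 = p.1 ∪ (fun y => y + z) '' p.1 ∪ (fun y => y - z) '' p.1 := by
    rintro ⟨Y, hYf, hYG⟩
    obtain ⟨i₀, hi₀⟩ := unif Y (compact_unif Y hYf.isCompact hYG)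
    have hex : ∃ i, Good Y i := ⟨i₀, hi₀ Y subset_rfl⟩
    obtain ⟨n, hn⟩ := Nat.find_spec hex
    refine ⟨⟨Y ∪ (fun y => y + ((1/2 : ℝ)^(Nat.find hex)) • d n) '' Y ∪
      (fun y => y - ((1/2 : ℝ)^(Nat.find hex)) • d n) '' Y,
      (hYf.union (hYf.image _)).union (hYf.image _), ?_⟩,
      ((1/2 : ℝ)^(Nat.find hex)) • d n, Nat.find hex, ?_, ?_, rfl⟩
    · rintro _ ((hy | ⟨y, hy, rfl⟩) | ⟨y, hy, rfl⟩)
      · exact hYG hy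
      · exact (hn y hy).1
      · exact (hn y hy).2
    · rw [norm_smul, hd, Real.norm_eq_abs, abs_of_nonneg (by positivity)]
    · intro j hj
      exact Nat.find_min' hex hj
  choose nx zz ii hz hmin hnx using step
  let st : ℕ → St := fun n => Nat.rec ⟨{0}, Set.finite_singleton 0, by
    rintro _ rfl; exact hG0⟩ (fun _ p => nx p) n
  let z : ℕ → Z := fun n => zz (st n)
  have hst : ∀ n, (st (n+1)).1 = (st n).1 ∪ (fun y => y + z n) '' (st n).1 ∪
      (fun y => y - z n) '' (st n).1 := fun n => hnx (st n)
  have up1 : ∀ n, ∀ y ∈ (st n).1, ∀ a, Tri a → y + a • z n ∈ (st (n+1)).1 := by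
    intro n y hy a ha
    rw [hst]
    rcases ha with rfl | rfl | rfl
    · left; left; simpa using hy
    · left; right; exact ⟨y, hy, by simp⟩
    · right; exact ⟨y, hy, by simp [sub_eq_add_neg]⟩
  have down1 : ∀ n, ∀ y ∈ (st (n+1)).1, ∃ y' ∈ (st n).1, ∃ a, Tri a ∧ y = y' + a • z n := by
    intro n y hy
    rw [hst] at hy
    rcases hy with (hy | ⟨y', hy, rfl⟩) | ⟨y', hy, rfl⟩
    · exact ⟨y, hy, 0, Or.inl rfl, by simp⟩
    · exact ⟨y', hy, 1, Or.inr (Or.inl rfl), by simp⟩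
    · exact ⟨y', hy, -1, Or.inr (Or.inr rfl), by simp [sub_eq_add_neg]⟩
  have up : ∀ N M, N ≤ M → ∀ y ∈ (st N).1, ∀ θ : ℕ → ℝ, (∀ i, Tri (θ i)) →
      y + ∑ i ∈ Finset.Ico N M, θ i • z i ∈ (st M).1 := by
    intro N M hNM y hy θ hθ
    induction M, hNM using Nat.le_induction with
    | base => simpa using hy
    | succ M hM ih =>
      rw [Finset.sum_Ico_succ_top hM, ← add_assoc]
      exact up1 M _ ih _ (hθ M)
  have down : ∀ N M, N ≤ M → ∀ y ∈ (st M).1, ∃ y' ∈ (st N).1, ∃ θ : ℕ → ℝ, (∀ i, Tri (θ i)) ∧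
      y = y' + ∑ i ∈ Finset.Ico N M, θ i • z i := by
    intro N M hNM
    induction M, hNM using Nat.le_induction with
    | base => intro y hy; exact ⟨y, hy, fun _ => 0, fun _ => Or.inl rfl, by simp⟩
    | succ M hM ih =>
      intro y hy
      obtain ⟨y1, hy1, a, ha, rfl⟩ := down1 M y hy
      obtain ⟨y2, hy2, θ, hθ, rfl⟩ := ih y1 hy1
      refine ⟨y2, hy2, Function.update θ M a, fun i => ?_, ?_⟩
      · by_cases h : i = M
        · subst h; simpa using ha
        · simpa [h] using hθ i
      · rw [Finset.sum_Ico_succ_top hM, ← add_assoc, Function.update_self]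
        congr 2
        refine Finset.sum_congr rfl (fun i hi => ?_)
        rw [Function.update_of_ne (Finset.mem_Ico.1 hi).2.ne]
  have hmono : ∀ N M, N ≤ M → (st N).1 ⊆ (st M).1 := by
    intro N M h y hy
    have := up N M h y hy (fun _ => 0) (fun _ => Or.inl rfl)
    simpa using this
  have notT : ¬ ∀ η > 0, ∃ N, ∀ M ≥ N, ∀ θ : ℕ → ℝ, (∀ i, Tri (θ i)) →
      ‖∑ i ∈ Finset.Ico N M, θ i • z i‖ < η := by
    intro hT
    let Y : Set Z := ⋃ n, (st n).1
    have htb : TotallyBounded Y := by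
      rw [Metric.totallyBounded_iff]
      intro η hη
      obtain ⟨N, hN⟩ := hT η hη
      refine ⟨(st N).1, (st N).2.1, ?_⟩
      intro y hy
      obtain ⟨M, hM⟩ := Set.mem_iUnion.1 hy
      have hM' := hmono M (max N M) (le_max_right _ _) hM
      obtain ⟨y', hy', θ, hθ, rfl⟩ := down N (max N M) (le_max_left _ _) y hM'
      refine Set.mem_biUnion hy' ?_
      rw [mem_ball_iff_norm, add_sub_cancel_left]
      exact hN _ (le_max_left _ _) θ hθ
    have hK : IsCompact (closure Y) :=
      htb.closure.isCompact_of_isClosed isClosed_closure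
    have hKG : closure Y ⊆ G := closure_minimal (Set.iUnion_subset (fun n => (st n).2.2)) hGc
    obtain ⟨i, hi⟩ := unif _ (compact_unif _ hK hKG)
    obtain ⟨N, hN⟩ := hT ((1/2 : ℝ)^i) (by positivity)
    have h1 := hN (N+1) (Nat.le_succ N) (fun _ => 1) (fun _ => Or.inr (Or.inl rfl))
    rw [Nat.Ico_succ_singleton, Finset.sum_singleton, one_smul] at h1
    have h2 := hmin (st N) i (hi _ ((Set.subset_iUnion (fun n => (st n).1) N).trans subset_closure))
    have h3 : ‖z N‖ = (1/2 : ℝ)^(ii (st N)) * 2 := hz (st N)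
    have h4 : (1/2 : ℝ)^i ≤ (1/2 : ℝ)^(ii (st N)) :=
      pow_le_pow_of_le_one (by norm_num) (by norm_num) h2
    have h5 : 0 < (1/2 : ℝ)^i := by positivity
    linarith
  push Not at notT
  obtain ⟨η, hη, hblock⟩ := notT
  choose MM hMM θ hθ hnorm using hblock
  let Ns : ℕ → ℕ := fun s => Nat.rec 0 (fun _ N => MM N) s
  have hNs : ∀ s, Ns (s+1) = MM (Ns s) := fun s => rfl
  let w : ℕ → Z := fun s => ∑ i ∈ Finset.Ico (Ns s) (MM (Ns s)), θ (Ns s) i • z i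
  refine ⟨w, η, hη, fun s => hnorm (Ns s), ?_⟩
  have hall : ∀ (τ : ℕ → ℝ), (∀ s, Tri (τ s)) → ∀ S, ∑ s ∈ Finset.range S, τ s • w s ∈ (st (Ns S)).1 := by
    intro τ hτ S
    induction S with
    | zero => simp [Ns, st]
    | succ S ih =>
      rw [Finset.sum_range_succ, hNs]
      have := up (Ns S) (MM (Ns S)) (hMM _) _ ih (fun i => τ S * θ (Ns S) i)
        (fun i => (hτ S).mul (hθ _ i))
      simp only [w]
      rw [Finset.smul_sum]
      simpa only [smul_smul] using this
  intro F σ hσ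
  obtain ⟨S, hS⟩ : ∃ S, F ⊆ Finset.range S := ⟨F.sup id + 1, fun s hs =>
    Finset.mem_range.2 (Nat.lt_succ_of_le (Finset.le_sup (f := id) hs))⟩
  have h1 := hall (fun s => if s ∈ F then σ s else 0) (fun s => by
    by_cases h : s ∈ F
    · simp only [h, if_true]; exact Or.inr (hσ s)
    · simp only [h, if_false]; exact Or.inl rfl) S
  have h2 : ∑ s ∈ Finset.range S, (if s ∈ F then σ s else 0) • w s = ∑ s ∈ F, σ s • w s := by
    rw [← Finset.sum_subset hS (f := fun s => (if s ∈ F then σ s else 0) • w s)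
      (fun s _ hs => by simp [hs])]
    exact Finset.sum_congr rfl (fun s hs => by simp [hs])
  rw [h2] at h1
  obtain ⟨m, hm⟩ := hGm _ ((st (Ns S)).2.2 h1)
  exact hm.trans (hr1 m)

lemma spear_abs (e : X →L[ℝ] ℝ) (he1 : ‖e‖ ≤ 1)
    (he : ∀ S : Set X, IsSlc S → ∀ ε > 0, ∃ x ∈ S, 1 - ε < |e x|)
    (ω : (X →L[ℝ] ℝ) →L[ℝ] ℝ) (hω : ω ∈ dExt (X →L[ℝ] ℝ)) : |ω e| = 1 := by
  refine le_antisymm (ball_le_one (dExt_norm hω) he1) ?_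
  by_contra hlt
  push Not at hlt
  set ε := (1 - |ω e|) / 2 with hε
  have hε0 : 0 < ε := by rw [hε]; linarith
  have hU : {ω' : (X →L[ℝ] ℝ) →L[ℝ] ℝ | |ω' e| < 1 - ε} ∈ pnhds ω :=
    ((pnhds_tendsto ω e).abs).eventually_lt_const (by rw [hε]; linarith)
  obtain ⟨f, c, hc, h⟩ := choquet hω hU
  have hcf : c < ‖f‖ := by
    have h1 := ω.le_opNorm f
    have h2 := le_abs_self (ω f)
    rw [Real.norm_eq_abs] at h1
    nlinarith [norm_nonneg f, dExt_norm hω]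
  obtain ⟨x, hx⟩ := exists_deep f c hcf
  obtain ⟨x', ⟨hx1, hx2⟩, hx3⟩ := he (slc f c) ⟨f, c, rfl, x, hx⟩ ε hε0
  have := h (NormedSpace.inclusionInDoubleDual ℝ X x')
    ((NormedSpace.double_dual_bound ℝ X x').trans hx1) hx2
  have h' : |e x'| < 1 - ε := this
  linarith

lemma main_thm (hinf : ¬ FiniteDimensional ℝ X) (hADP : RealAlternativeDaugavetProperty X) :
    ContainsCopyOfL1 (X →L[ℝ] ℝ) := by
  classical
  by_contra hno
  have hnt : Nontrivial X := by
    by_contra h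
    rw [not_nontrivial_iff_subsingleton] at h
    exact hinf inferInstance
  have hinj := dExt_infinite hinf
  let emb := hinj.natEmbedding
  let e : ℕ → X →L[ℝ] ℝ := fun n => (emb n).1
  have he_inj : Function.Injective e := fun a b h => emb.injective (Subtype.ext h)
  have he_ext : ∀ n, e n ∈ dExt X := fun n => (emb n).2
  have habs : ∀ n, ∀ ω ∈ dExt (X →L[ℝ] ℝ), |ω (e n)| = 1 := fun n ω hω =>
    spear_abs (e n) (dExt_norm (he_ext n))
      (fun S hS ε hε => ext_spear hADP hno (e n) (he_ext n) S hS ε hε) ω hω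
  have hpm : ∀ n, ∀ ω ∈ dExt (X →L[ℝ] ℝ), ω (e n) = 1 ∨ ω (e n) = -1 := fun n ω hω =>
    (abs_eq zero_le_one).1 (habs n ω hω)
  have hdist : ∀ m n, m ≠ n → ‖e m - e n‖ = 2 := by
    intro m n hmn
    obtain ⟨ω, hω, hωe⟩ := dExt_attain (e m - e n)
    have hpos : 0 < ‖e m - e n‖ := norm_pos_iff.2 (sub_ne_zero.2 (fun h => hmn (he_inj h)))
    rw [← hωe, map_sub] at hpos ⊢
    rcases hpm m ω hω with h | h <;> rcases hpm n ω hω with h' | h' <;> rw [h, h'] at hpos ⊢ <;> linarith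
  rcases rosenthal_dichotomy (Ω := dExt (X →L[ℝ] ℝ)) (fun n => {ω | ω.1 (e n) = 1}) with
    ⟨M, hM, hconv⟩ | ⟨k, hk⟩
  · let φ : ℕ → ℕ := fun n => (hM.natEmbedding M n).1
    have hφ : Function.Injective φ := fun a b h =>
      (hM.natEmbedding M).injective (Subtype.ext h)
    have hφM : ∀ n, φ n ∈ M := fun n => (hM.natEmbedding M n).2
    obtain ⟨w, η, hη, hw1, hw2⟩ := wuc_construct (Z := X →L[ℝ] ℝ) (dExt (X →L[ℝ] ℝ))
      (fun ω hω => dExt_norm hω) dExt_attain (fun n => e (φ (n+1)) - e (φ n))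
      (fun n => hdist _ _ (fun h => by have := hφ h; omega))
      (fun m => {ω | ω ∈ dExt (X →L[ℝ] ℝ) ∧ ∀ n ≥ m, ω (e (φ n)) = ω (e (φ m))})
      (fun m ω hω => hω.1) (fun ω hω => by
        have hev : ∀ P : ℕ → Prop, {n ∈ M | P n}.Finite → ∃ m, ∀ n ≥ m, ¬ P (φ n) := by
          intro P hP
          have h1 : {n | P (φ n)}.Finite := by
            refine (hP.preimage (f := φ) (hφ.injOn)).subset ?_
            intro n hn
            exact ⟨hφM n, hn⟩
          obtain ⟨b, hb⟩ := h1.bddAbove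
          refine ⟨b + 1, fun n hn hPn => ?_⟩
          have := hb hPn
          omega
        rcases hconv ⟨ω, hω⟩ (Set.mem_univ _) with h | h
        · obtain ⟨m, hm⟩ := hev (fun n => ω (e n) = 1) h
          refine ⟨m, hω, fun n hn => ?_⟩
          rw [(hpm (φ n) ω hω).resolve_left (hm n hn), (hpm (φ m) ω hω).resolve_left (hm m le_rfl)]
        · obtain ⟨m, hm⟩ := hev (fun n => ¬ ω (e n) = 1) h
          refine ⟨m, hω, fun n hn => ?_⟩
          rw [not_not.1 (hm n hn), not_not.1 (hm m le_rfl)])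
      (fun m ω hω n hn => by
        rw [map_sub, hω.2 n hn, hω.2 (n+1) (by omega), sub_self])
    exact hno (l1_of_wuc w η hη hw1 hw2)
  · apply hno
    refine l1_of_indep (fun n => e (k n)) (fun n => dExt_norm (he_ext _)) (-1) 2 two_pos ?_
    intro N θ
    obtain ⟨ω, hω⟩ := hk N θ
    refine ⟨ω.1, dExt_norm ω.2, fun i hi => ⟨fun h => ?_, fun h => ?_⟩⟩
    · have : ω.1 (e (k i)) = 1 := (hω i hi).1 h
      rw [this]; norm_num
    · have : ¬ ω.1 (e (k i)) = 1 := (hω i hi).2 h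
      rw [(hpm _ ω.1 ω.2).resolve_left this]
end partD

/-- If `X` is an infinite-dimensional real Banach space with the
alternative Daugavet property, then the dual `X*` contains an isomorphic copy of `ℓ₁`. -/
theorem statement16 {X : Type*} [NormedAddCommGroup X] [NormedSpace ℝ X]
    [CompleteSpace X] (hinf : ¬ FiniteDimensional ℝ X)
    (hADP : RealAlternativeDaugavetProperty X) :
    ContainsCopyOfL1 (X →L[ℝ] ℝ) := by
  exact main_thm hinf hADP
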